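/- There exists a universal constant N such that for every classical solution (u,Π) of the 3D Navier–Stokes equations on Q(1) (not necessarily axisymmetric), every z₀=(x₀,t₀)∈Q(1/8), and every 0<ρ≤1/4, one has A(z₀,ρ)+E(z₀,ρ) ≤ N·(1+C(z₀,2ρ)+D(z₀,2ρ)). -/

import Mathlib

open Real MeasureTheory Set
open scoped ENNReal
noncomputable section

abbrev E3 := EuclideanSpace ℝ (Fin 3)

/-- `i`-th standard basis vector of `ℝ³`. -/
def ee (i : Fin 3) : E3 := EuclideanSpace.single i 1

/-- partial derivative of a scalar function in the direction `eᵢ`. -/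
def pd (f : E3 → ℝ) (i : Fin 3) (x : E3) : ℝ := fderiv ℝ f x (ee i)

/-- Laplacian of a scalar function. -/
def lap (f : E3 → ℝ) (x : E3) : ℝ := ∑ i, pd (fun y => pd f i y) i x

/-- parabolic cylinder `Q(z₀,R) = B(x₀,R) × (t₀ - R², t₀)`. -/
def Qyl (z₀ : E3 × ℝ) (R : ℝ) : Set (E3 × ℝ) :=
  (Metric.ball z₀.1 R) ×ˢ (Ioo (z₀.2 - R ^ 2) z₀.2)

/-- `(u, P)` is a classical solution of the 3D Navier–Stokes equations on the open set `U`,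
which contains the closure of `Q(1)`. -/
structure IsNSQ1 (u : E3 → ℝ → E3) (P : E3 → ℝ → ℝ) (U : Set (E3 × ℝ)) : Prop where
  open_U : IsOpen U
  subset_U : closure (Qyl (0, 0) 1) ⊆ U
  smooth_u : ContDiffOn ℝ (⊤ : ℕ∞) (fun z : E3 × ℝ => u z.1 z.2) U
  smooth_P : ContDiffOn ℝ (⊤ : ℕ∞) (fun z : E3 × ℝ => P z.1 z.2) U
  momentum : ∀ x : E3, ∀ t : ℝ, (x, t) ∈ U → ∀ j : Fin 3,
    deriv (fun s => u x s j) t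
      + (∑ i, u x t i * pd (fun y => u y t j) i x)
      - lap (fun y => u y t j) x
      + pd (fun y => P y t) j x = 0
  divfree : ∀ x : E3, ∀ t : ℝ, (x, t) ∈ U → ∑ i, pd (fun y => u y t i) i x = 0

/-- `(u, P)` is axially symmetric on `U`: in cylindrical coordinates
`u = uʳ eᵣ + uᶿ e_θ + u³ e₃` and `P = p(r, x₃, t)`. -/
def IsAxisym (u : E3 → ℝ → E3) (P : E3 → ℝ → ℝ) (U : Set (E3 × ℝ)) : Prop :=
  ∃ ur uθ u3 pp : ℝ → ℝ → ℝ → ℝ,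
    ∀ x : E3, ∀ t : ℝ, (x, t) ∈ U → x 0 ^ 2 + x 1 ^ 2 ≠ 0 →
      u x t 0 = ur (Real.sqrt (x 0 ^ 2 + x 1 ^ 2)) (x 2) t
                  * (x 0 / Real.sqrt (x 0 ^ 2 + x 1 ^ 2))
                - uθ (Real.sqrt (x 0 ^ 2 + x 1 ^ 2)) (x 2) t
                  * (x 1 / Real.sqrt (x 0 ^ 2 + x 1 ^ 2)) ∧
      u x t 1 = ur (Real.sqrt (x 0 ^ 2 + x 1 ^ 2)) (x 2) t
                  * (x 1 / Real.sqrt (x 0 ^ 2 + x 1 ^ 2))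
                + uθ (Real.sqrt (x 0 ^ 2 + x 1 ^ 2)) (x 2) t
                  * (x 0 / Real.sqrt (x 0 ^ 2 + x 1 ^ 2)) ∧
      u x t 2 = u3 (Real.sqrt (x 0 ^ 2 + x 1 ^ 2)) (x 2) t ∧
      P x t = pp (Real.sqrt (x 0 ^ 2 + x 1 ^ 2)) (x 2) t

/-- `Γ = r uᶿ = x₁ u₂ - x₂ u₁`. -/
def Gam (u : E3 → ℝ → E3) (x : E3) (t : ℝ) : ℝ := x 0 * u x t 1 - x 1 * u x t 0

/-- Cartesian components of `b = uʳ eᵣ + u³ e₃ = u - uᶿ e_θ`. -/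
def bcomp (u : E3 → ℝ → E3) (x : E3) (t : ℝ) : Fin 3 → ℝ :=
  ![u x t 0 + x 1 * Gam u x t / (x 0 ^ 2 + x 1 ^ 2),
    u x t 1 - x 0 * Gam u x t / (x 0 ^ 2 + x 1 ^ 2),
    u x t 2]

/-- Euclidean norm of `b`. -/
def bnorm (u : E3 → ℝ → E3) (x : E3) (t : ℝ) : ℝ :=
  Real.sqrt (∑ i, (bcomp u x t i) ^ 2)

/-- `A(z₀,R)`. -/
def AA (u : E3 → ℝ → E3) (z₀ : E3 × ℝ) (R : ℝ) : ℝ :=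
  ⨆ t ∈ Ioo (z₀.2 - R ^ 2) z₀.2, R⁻¹ * ∫ x in Metric.ball z₀.1 R, ‖u x t‖ ^ 2

/-- `E(z₀,R)`. -/
def EE (u : E3 → ℝ → E3) (z₀ : E3 × ℝ) (R : ℝ) : ℝ :=
  R⁻¹ * ∫ t in Ioo (z₀.2 - R ^ 2) z₀.2, ∫ x in Metric.ball z₀.1 R,
    ∑ j, ∑ i, (pd (fun y => u y t j) i x) ^ 2

/-- `C(z₀,R)`. -/
def CC (u : E3 → ℝ → E3) (z₀ : E3 × ℝ) (R : ℝ) : ℝ :=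
  (R ^ 2)⁻¹ * ∫ t in Ioo (z₀.2 - R ^ 2) z₀.2, ∫ x in Metric.ball z₀.1 R, ‖u x t‖ ^ 3

/-- `D(z₀,R)`. -/
def DD (P : E3 → ℝ → ℝ) (z₀ : E3 × ℝ) (R : ℝ) : ℝ :=
  (R ^ 2)⁻¹ * ∫ t in Ioo (z₀.2 - R ^ 2) z₀.2, ∫ x in Metric.ball z₀.1 R, |P x t| ^ (3/2 : ℝ)

/-- `𝓔(z₀,R) = A + E + D`. -/
def EEE (u : E3 → ℝ → E3) (P : E3 → ℝ → ℝ) (z₀ : E3 × ℝ) (R : ℝ) : ℝ :=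
  AA u z₀ R + EE u z₀ R + DD P z₀ R

/-- the weight `ω(R) = (ln ln (100/R))⁻¹`. -/
def omg (R : ℝ) : ℝ := (Real.log (Real.log (100 / R)))⁻¹

/-- `G(z₀,R) = R^{1-3/p-2/q} ‖b‖_{L^{p,q}(Q(z₀,R))}` (space norm `Lᵖ`, time norm `L^q`). -/
def Gfun (u : E3 → ℝ → E3) (p q : ℝ≥0∞) (z₀ : E3 × ℝ) (R : ℝ) : ℝ :=
  R ^ (1 - 3 / p.toReal - 2 / q.toReal) *
    (eLpNorm (fun t =>
        (eLpNorm (fun x => bnorm u x t) p (volume.restrict (Metric.ball z₀.1 R))).toReal)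
      q (volume.restrict (Ioo (z₀.2 - R ^ 2) z₀.2))).toReal

/-- `m_R = inf_{Q(R)} Γ`. -/
def mR (u : E3 → ℝ → E3) (R : ℝ) : ℝ :=
  sInf ((fun z : E3 × ℝ => Gam u z.1 z.2) '' Qyl (0, 0) R)

/-- `M_R = sup_{Q(R)} Γ`. -/
def MMR (u : E3 → ℝ → E3) (R : ℝ) : ℝ :=
  sSup ((fun z : E3 × ℝ => Gam u z.1 z.2) '' Qyl (0, 0) R)

/-- `J_R = M_R - m_R`. -/
def JR (u : E3 → ℝ → E3) (R : ℝ) : ℝ := MMR u R - mR u R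

/-- the normalized function `h`. -/
def hfun (u : E3 → ℝ → E3) (R : ℝ) (x : E3) (t : ℝ) : ℝ :=
  if -(mR u R) < MMR u R then 2 * (MMR u R - Gam u x t) / JR u R
  else 2 * (Gam u x t - mR u R) / JR u R

/-- oscillation of `Γ` over `Q(z₀,R)`. -/
def oscΓ (u : E3 → ℝ → E3) (z₀ : E3 × ℝ) (R : ℝ) : ℝ :=
  sSup ((fun z : E3 × ℝ => Gam u z.1 z.2) '' Qyl z₀ R) -
    sInf ((fun z : E3 × ℝ => Gam u z.1 z.2) '' Qyl z₀ R)

/-- Directional derivative of a scalar function on space-time. -/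
def dirD (w : E3 × ℝ) (F : E3 × ℝ → ℝ) (z : E3 × ℝ) : ℝ := fderiv ℝ F z w

/-- The spatial direction `eᵢ` in space-time. -/
def es (i : Fin 3) : E3 × ℝ := (ee i, 0)

/-- The time direction in space-time. -/
def et : E3 × ℝ := (0, 1)

/-- The tested energy flux whose spatial divergence appears in the local energy identity. -/
def energyFlux (v : Fin 3 → E3 × ℝ → ℝ) (p φ : E3 × ℝ → ℝ) (i : Fin 3) (z : E3 × ℝ) : ℝ :=
  φ z * dirD (es i) (fun z => ∑ j, v j z * v j z) z
    - (∑ j, v j z * v j z) * dirD (es i) φ z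
    - φ z * v i z * (∑ j, v j z * v j z + 2 * p z)

/-- The right-hand side of the local energy identity. -/
def energySource (v : Fin 3 → E3 × ℝ → ℝ) (p φ : E3 × ℝ → ℝ) (z : E3 × ℝ) : ℝ :=
  (∑ j, v j z * v j z) * (dirD et φ z + ∑ i, dirD (es i) (dirD (es i) φ) z)
    + (∑ j, v j z * v j z + 2 * p z) * ∑ i, v i z * dirD (es i) φ z

/-- The Navier–Stokes system at a point of space-time, for functions on space-time. -/
def NSAt (v : Fin 3 → E3 × ℝ → ℝ) (p : E3 × ℝ → ℝ) (z : E3 × ℝ) : Prop :=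
  (∀ j, dirD et (v j) z + (∑ i, v i z * dirD (es i) (v j) z)
    - (∑ i, dirD (es i) (dirD (es i) (v j)) z) + dirD (es j) p z = 0) ∧
  ∑ i, dirD (es i) (v i) z = 0

lemma dirD_contDiff {w : E3 × ℝ} {F : E3 × ℝ → ℝ} (hF : ContDiff ℝ (⊤ : ℕ∞) F) :
    ContDiff ℝ (⊤ : ℕ∞) (dirD w F) :=
  (hF.fderiv_right (m := (⊤ : ℕ∞)) (by simp)).clm_apply contDiff_const

lemma dirD_add {w : E3 × ℝ} {F G : E3 × ℝ → ℝ} (hF : ContDiff ℝ (⊤ : ℕ∞) F)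
    (hG : ContDiff ℝ (⊤ : ℕ∞) G) :
    dirD w (fun z => F z + G z) = fun z => dirD w F z + dirD w G z := by
  funext z
  unfold dirD
  rw [fderiv_fun_add (hF.differentiable (by simp) z) (hG.differentiable (by simp) z)]
  rfl

lemma dirD_sub {w : E3 × ℝ} {F G : E3 × ℝ → ℝ} (hF : ContDiff ℝ (⊤ : ℕ∞) F)
    (hG : ContDiff ℝ (⊤ : ℕ∞) G) :
    dirD w (fun z => F z - G z) = fun z => dirD w F z - dirD w G z := by
  funext z
  unfold dirD
  rw [fderiv_fun_sub (hF.differentiable (by simp) z) (hG.differentiable (by simp) z)]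
  rfl

lemma dirD_mul {w : E3 × ℝ} {F G : E3 × ℝ → ℝ} (hF : ContDiff ℝ (⊤ : ℕ∞) F)
    (hG : ContDiff ℝ (⊤ : ℕ∞) G) :
    dirD w (fun z => F z * G z) = fun z => F z * dirD w G z + G z * dirD w F z := by
  funext z
  unfold dirD
  rw [fderiv_fun_mul (hF.differentiable (by simp) z) (hG.differentiable (by simp) z)]
  simp

lemma dirD_const_mul {w : E3 × ℝ} (c : ℝ) {F : E3 × ℝ → ℝ} (hF : ContDiff ℝ (⊤ : ℕ∞) F) :
    dirD w (fun z => c * F z) = fun z => c * dirD w F z := by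
  funext z
  unfold dirD
  rw [fderiv_const_mul (hF.differentiable (by simp) z)]
  rfl

lemma dirD_energy {w : E3 × ℝ} {v : Fin 3 → E3 × ℝ → ℝ}
    (hv : ∀ j, ContDiff ℝ (⊤ : ℕ∞) (v j)) :
    dirD w (fun z => ∑ j, v j z * v j z) = fun z => 2 * ∑ j, v j z * dirD w (v j) z := by
  have h0 := hv 0
  have h1 := hv 1
  have h2 := hv 2
  simp only [Fin.sum_univ_three]
  rw [dirD_add (by fun_prop) (by fun_prop), dirD_add (by fun_prop) (by fun_prop),
    dirD_mul h0 h0, dirD_mul h1 h1, dirD_mul h2 h2]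
  funext z
  ring

lemma dirD_dirD_energy {w : E3 × ℝ} {v : Fin 3 → E3 × ℝ → ℝ}
    (hv : ∀ j, ContDiff ℝ (⊤ : ℕ∞) (v j)) :
    dirD w (dirD w (fun z => ∑ j, v j z * v j z)) = fun z =>
      2 * ∑ j, (dirD w (v j) z ^ 2 + v j z * dirD w (dirD w (v j)) z) := by
  rw [dirD_energy hv]
  have h0 := hv 0
  have h1 := hv 1
  have h2 := hv 2
  have k0 := dirD_contDiff (w := w) h0
  have k1 := dirD_contDiff (w := w) h1
  have k2 := dirD_contDiff (w := w) h2
  simp only [Fin.sum_univ_three]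
  rw [dirD_const_mul _ (by fun_prop), dirD_add (by fun_prop) (by fun_prop),
    dirD_add (by fun_prop) (by fun_prop), dirD_mul h0 k0, dirD_mul h1 k1, dirD_mul h2 k2]
  funext z
  ring

lemma contDiff_energy {v : Fin 3 → E3 × ℝ → ℝ} (hv : ∀ j, ContDiff ℝ (⊤ : ℕ∞) (v j)) :
    ContDiff ℝ (⊤ : ℕ∞) (fun z => ∑ j, v j z * v j z) := by
  fun_prop

lemma contDiff_energyFlux {v : Fin 3 → E3 × ℝ → ℝ} {p φ : E3 × ℝ → ℝ}
    (hv : ∀ j, ContDiff ℝ (⊤ : ℕ∞) (v j)) (hp : ContDiff ℝ (⊤ : ℕ∞) p)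
    (hφ : ContDiff ℝ (⊤ : ℕ∞) φ) (i : Fin 3) :
    ContDiff ℝ (⊤ : ℕ∞) (energyFlux v p φ i) := by
  have h1 := contDiff_energy hv
  have h2 := dirD_contDiff (w := es i) h1
  have h3 := dirD_contDiff (w := es i) hφ
  unfold energyFlux
  fun_prop

lemma dirD_energyFlux {v : Fin 3 → E3 × ℝ → ℝ} {p φ : E3 × ℝ → ℝ}
    (hv : ∀ j, ContDiff ℝ (⊤ : ℕ∞) (v j)) (hp : ContDiff ℝ (⊤ : ℕ∞) p)
    (hφ : ContDiff ℝ (⊤ : ℕ∞) φ) (i : Fin 3) (z : E3 × ℝ) :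
    dirD (es i) (energyFlux v p φ i) z =
      φ z * (2 * ∑ j, (dirD (es i) (v j) z ^ 2 + v j z * dirD (es i) (dirD (es i) (v j)) z))
      - (∑ j, v j z * v j z) * dirD (es i) (dirD (es i) φ) z
      - (φ z * dirD (es i) (v i) z + v i z * dirD (es i) φ z) * (∑ j, v j z * v j z + 2 * p z)
      - φ z * v i z * (2 * ∑ j, v j z * dirD (es i) (v j) z + 2 * dirD (es i) p z) := by
  have hq := contDiff_energy hv
  have hvi := hv i
  have h2 := dirD_contDiff (w := es i) hq
  have h3 := dirD_contDiff (w := es i) hφ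
  have e : dirD (es i) (fun z => ∑ j, v j z * v j z + 2 * p z) = fun z =>
      2 * ∑ j, v j z * dirD (es i) (v j) z + 2 * dirD (es i) p z := by
    rw [dirD_add hq (by fun_prop), dirD_energy hv, dirD_const_mul _ hp]
  unfold energyFlux
  rw [dirD_sub (by fun_prop) (by fun_prop), dirD_sub (by fun_prop) (by fun_prop),
    dirD_mul hφ h2, dirD_mul hq h3, dirD_mul (F := fun z => φ z * v i z) (by fun_prop)
      (by fun_prop), dirD_mul hφ hvi, e, dirD_dirD_energy hv, dirD_energy hv]
  ring

/-- Pointwise form of the local energy identity. -/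
lemma local_energy_identity {v : Fin 3 → E3 × ℝ → ℝ} {p φ : E3 × ℝ → ℝ}
    (hv : ∀ j, ContDiff ℝ (⊤ : ℕ∞) (v j)) (hp : ContDiff ℝ (⊤ : ℕ∞) p)
    (hφ : ContDiff ℝ (⊤ : ℕ∞) φ) {z : E3 × ℝ} (hz : φ z ≠ 0 → NSAt v p z) :
    dirD et (fun z => (∑ j, v j z * v j z) * φ z) z
      + 2 * φ z * ∑ j, ∑ i, dirD (es i) (v j) z ^ 2
      = energySource v p φ z + ∑ i, dirD (es i) (energyFlux v p φ i) z := by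
  have hq := contDiff_energy hv
  rw [dirD_mul hq hφ, dirD_energy hv]
  simp only [dirD_energyFlux hv hp hφ]
  unfold energySource
  rcases eq_or_ne (φ z) 0 with h | h
  · simp only [Fin.sum_univ_three, h]
    ring
  · obtain ⟨hm, hd⟩ := hz h
    have m0 := hm 0
    have m1 := hm 1
    have m2 := hm 2
    simp only [Fin.sum_univ_three] at m0 m1 m2 hd ⊢
    linear_combination 2 * φ z * v 0 z * m0 + 2 * φ z * v 1 z * m1 + 2 * φ z * v 2 z * m2
      + φ z * (v 0 z * v 0 z + v 1 z * v 1 z + v 2 z * v 2 z + 2 * p z) * hd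

lemma integrableOn_cylinder {F : E3 × ℝ → ℝ} (hF : Continuous F) (c : E3) (r a b : ℝ) :
    IntegrableOn F (Metric.ball c r ×ˢ Ioo a b) :=
  (hF.continuousOn.integrableOn_compact ((isCompact_closedBall c r).prod isCompact_Icc)).mono_set
    (prod_mono Metric.ball_subset_closedBall Ioo_subset_Icc_self)

lemma integral_cylinder {F : E3 × ℝ → ℝ} (hF : Continuous F) (c : E3) (r a b : ℝ) :
    ∫ t in Ioo a b, ∫ x in Metric.ball c r, F (x, t)
      = ∫ z in Metric.ball c r ×ˢ Ioo a b, F z := by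
  have h := integrableOn_cylinder hF c r a b
  rw [IntegrableOn, Measure.volume_eq_prod, ← Measure.prod_restrict] at h
  rw [Measure.volume_eq_prod, ← Measure.prod_restrict, integral_prod_symm _ h]

lemma dirD_eq_zero_of_exterior {F : E3 × ℝ → ℝ} {c : E3} {r' : ℝ}
    (hF : ∀ z : E3 × ℝ, r' ≤ dist z.1 c → F z = 0) (w : E3 × ℝ) {z : E3 × ℝ}
    (hz : r' < dist z.1 c) : dirD w F z = 0 := by
  have : F =ᶠ[nhds z] fun _ => 0 := by
    have ho : IsOpen {z : E3 × ℝ | r' < dist z.1 c} :=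
      isOpen_lt continuous_const (by fun_prop)
    filter_upwards [ho.mem_nhds hz] with y hy
    exact hF y (le_of_lt hy)
  unfold dirD
  rw [this.fderiv_eq]
  simp

lemma pd_slice {F : E3 × ℝ → ℝ} {x : E3} {t : ℝ} (hF : DifferentiableAt ℝ F (x, t)) (i : Fin 3) :
    pd (fun y => F (y, t)) i x = dirD (es i) F (x, t) := by
  have h2 : HasFDerivAt (fun y : E3 => (y, t)) (ContinuousLinearMap.inl ℝ E3 ℝ) x :=
    hasFDerivAt_prodMk_left x t
  have h := hF.hasFDerivAt.comp x h2
  unfold pd dirD es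
  have e : (fun y => F (y, t)) = F ∘ fun y : E3 => (y, t) := rfl
  rw [e, h.fderiv]
  simp

lemma hasDerivAt_slice {F : E3 × ℝ → ℝ} {x : E3} {t : ℝ} (hF : DifferentiableAt ℝ F (x, t)) :
    HasDerivAt (fun s => F (x, s)) (dirD et F (x, t)) t := by
  have h2 : HasFDerivAt (fun s : ℝ => (x, s)) (ContinuousLinearMap.inr ℝ E3 ℝ) t :=
    hasFDerivAt_prodMk_right x t
  have h := (hF.hasFDerivAt.comp t h2).hasDerivAt
  simp only [ContinuousLinearMap.comp_apply, ContinuousLinearMap.inr_apply] at h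
  exact h

lemma integral_dirD_space {W : E3 × ℝ → ℝ} (hW : ContDiff ℝ (⊤ : ℕ∞) W) {c : E3} {r' r : ℝ}
    (hr : r' < r) (h0 : ∀ z : E3 × ℝ, r' ≤ dist z.1 c → W z = 0) (i : Fin 3) (t : ℝ) :
    ∫ x in Metric.ball c r, dirD (es i) W (x, t) = 0 := by
  have hs : ContDiff ℝ (⊤ : ℕ∞) (fun x => W (x, t)) := by fun_prop
  have hc : HasCompactSupport (fun x => W (x, t)) := by
    refine HasCompactSupport.intro (isCompact_closedBall c r') fun x hx => h0 _ ?_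
    simp only [Metric.mem_closedBall, not_le] at hx
    exact hx.le
  have hd : ∀ x, fderiv ℝ (fun x => W (x, t)) x (ee i) = dirD (es i) W (x, t) := fun x =>
    pd_slice (hW.differentiable (by simp) _) i
  have hsup : ∀ x, x ∉ Metric.ball c r → dirD (es i) W (x, t) = 0 := by
    intro x hx
    simp only [Metric.mem_ball, not_lt] at hx
    exact dirD_eq_zero_of_exterior h0 _ (lt_of_lt_of_le hr hx)
  rw [setIntegral_eq_integral_of_forall_compl_eq_zero hsup]
  have hcont : Continuous fun x => fderiv ℝ (fun x => W (x, t)) x (ee i) :=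
    (hs.continuous_fderiv (by simp)).clm_apply continuous_const
  have hci : HasCompactSupport fun x => fderiv ℝ (fun x => W (x, t)) x (ee i) :=
    hc.fderiv_apply ℝ (ee i)
  have key := integral_mul_fderiv_eq_neg_fderiv_mul_of_integrable (μ := (volume : Measure E3))
    (f := fun _ : E3 => (1 : ℝ)) (g := fun x => W (x, t)) (v := ee i)
    (by simp) (by simpa using hcont.integrable_of_hasCompactSupport hci)
    (by simpa using hs.continuous.integrable_of_hasCompactSupport hc)
    (by simp) (fun x _ => hs.differentiable (by simp) x)
  simp only [hd] at key
  simpa using key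

lemma integral_dirD_time {G : E3 × ℝ → ℝ} (hG : ContDiff ℝ (⊤ : ℕ∞) G) (c : E3) (r : ℝ)
    {s T : ℝ} (hsT : s ≤ T) :
    ∫ z in Metric.ball c r ×ˢ Ioo s T, dirD et G z
      = (∫ x in Metric.ball c r, G (x, T)) - ∫ x in Metric.ball c r, G (x, s) := by
  have hD : ContDiff ℝ (⊤ : ℕ∞) (dirD et G) := dirD_contDiff hG
  have hi : ∀ t, IntegrableOn (fun x => G (x, t)) (Metric.ball c r) := fun t =>
    ((hG.continuous.comp
        (by fun_prop : Continuous fun x : E3 => (x, t))).continuousOn.integrableOn_compact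
      (isCompact_closedBall c r)).mono_set Metric.ball_subset_closedBall
  have h := integrableOn_cylinder hD.continuous c r s T
  rw [Measure.volume_eq_prod] at h ⊢
  rw [setIntegral_prod _ h, ← integral_sub (hi T) (hi s)]
  refine integral_congr_ae (Filter.Eventually.of_forall fun x => ?_)
  simp only
  rw [← integral_Ioc_eq_integral_Ioo, ← intervalIntegral.integral_of_le hsT]
  refine intervalIntegral.integral_eq_sub_of_hasDerivAt
    (fun t _ => hasDerivAt_slice (hG.differentiable (by simp) _)) ?_
  exact (hD.continuous.comp (by fun_prop : Continuous fun t : ℝ => (x, t))).intervalIntegrable _ _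

lemma contDiff_energySource {v : Fin 3 → E3 × ℝ → ℝ} {p φ : E3 × ℝ → ℝ}
    (hv : ∀ j, ContDiff ℝ (⊤ : ℕ∞) (v j)) (hp : ContDiff ℝ (⊤ : ℕ∞) p)
    (hφ : ContDiff ℝ (⊤ : ℕ∞) φ) : ContDiff ℝ (⊤ : ℕ∞) (energySource v p φ) := by
  have h1 := dirD_contDiff (w := et) hφ
  have h2 := fun i => dirD_contDiff (w := es i) hφ
  have h3 := fun i => dirD_contDiff (w := es i) (h2 i)
  unfold energySource
  fun_prop

/-- Local energy equality for a test function vanishing at the initial time. -/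
lemma local_energy_equality {v : Fin 3 → E3 × ℝ → ℝ} {p φ : E3 × ℝ → ℝ}
    (hv : ∀ j, ContDiff ℝ (⊤ : ℕ∞) (v j)) (hp : ContDiff ℝ (⊤ : ℕ∞) p)
    (hφ : ContDiff ℝ (⊤ : ℕ∞) φ) {c : E3} {r' r s T : ℝ} (hr : r' < r) (hsT : s ≤ T)
    (h0 : ∀ z : E3 × ℝ, r' ≤ dist z.1 c → φ z = 0) (hs : ∀ x, φ (x, s) = 0)
    (hNS : ∀ z ∈ Metric.ball c r ×ˢ Ioo s T, NSAt v p z) :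
    (∫ x in Metric.ball c r, (∑ j, v j (x, T) * v j (x, T)) * φ (x, T))
      + ∫ z in Metric.ball c r ×ˢ Ioo s T, 2 * φ z * ∑ j, ∑ i, dirD (es i) (v j) z ^ 2
      = ∫ z in Metric.ball c r ×ˢ Ioo s T, energySource v p φ z := by
  have hq := contDiff_energy hv
  have hg : ContDiff ℝ (⊤ : ℕ∞) (fun z => (∑ j, v j z * v j z) * φ z) := hq.mul hφ
  have hdiss : ContDiff ℝ (⊤ : ℕ∞) fun z => 2 * φ z * ∑ j, ∑ i, dirD (es i) (v j) z ^ 2 := by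
    have := fun i j => dirD_contDiff (w := es i) (hv j)
    fun_prop
  have hfl := fun i => contDiff_energyFlux hv hp hφ i
  have hm : MeasurableSet (Metric.ball c r ×ˢ Ioo s T) :=
    measurableSet_ball.prod measurableSet_Ioo
  have hdiv : ∀ i, ∫ z in Metric.ball c r ×ˢ Ioo s T,
      dirD (es i) (energyFlux v p φ i) z = 0 := by
    intro i
    rw [← integral_cylinder (dirD_contDiff (hfl i)).continuous]
    have : ∀ t, ∫ x in Metric.ball c r, dirD (es i) (energyFlux v p φ i) (x, t) = 0 := by
      intro t
      refine integral_dirD_space (hfl i) (r' := (r' + r) / 2) (by linarith) (fun z hz => ?_) i t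
      have h1 : r' < dist z.1 c := by linarith
      unfold energyFlux
      rw [h0 z h1.le, dirD_eq_zero_of_exterior h0 _ h1]
      ring
    simp [this]
  have ht := integral_dirD_time hg c r hsT
  simp only [hs, mul_zero, integral_zero, sub_zero] at ht
  rw [← ht, ← integral_add (integrableOn_cylinder (dirD_contDiff hg).continuous c r s T)
    (integrableOn_cylinder hdiss.continuous c r s T)]
  rw [setIntegral_congr_fun hm (g := fun z => energySource v p φ z
    + ∑ i, dirD (es i) (energyFlux v p φ i) z)
    (fun z hz => local_energy_identity hv hp hφ fun _ => hNS z hz)]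
  rw [integral_add (integrableOn_cylinder (contDiff_energySource hv hp hφ).continuous c r s T)
    (integrableOn_cylinder (by
      have := fun i => (dirD_contDiff (w := es i) (hfl i)).continuous
      fun_prop) c r s T),
    integral_finsetSum _ fun i _ => integrableOn_cylinder
      (dirD_contDiff (hfl i)).continuous c r s T]
  simp [hdiv]

/-- A smooth cutoff, equal to one on the unit ball and supported in the ball of radius `3/2`. -/
def baseBump : ContDiffBump (0 : E3) := ⟨1, 3 / 2, by norm_num, by norm_num⟩

lemma pd_contDiff {g : E3 → ℝ} (hg : ContDiff ℝ (⊤ : ℕ∞) g) (i : Fin 3) :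
    ContDiff ℝ (⊤ : ℕ∞) (pd g i) :=
  (hg.fderiv_right (m := (⊤ : ℕ∞)) (by simp)).clm_apply contDiff_const

lemma exists_baseBump_bound : ∃ M : ℝ, 0 ≤ M ∧ ∀ (i : Fin 3) (y : E3),
    |pd baseBump i y| ≤ M ∧ |pd (pd baseBump i) i y| ≤ M := by
  have hf : ContDiff ℝ (⊤ : ℕ∞) (baseBump : E3 → ℝ) := baseBump.contDiff
  have hc : HasCompactSupport (baseBump : E3 → ℝ) := baseBump.hasCompactSupport
  have hc1 : ∀ i, HasCompactSupport (pd baseBump i) := fun i => hc.fderiv_apply ℝ (ee i)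
  have hc2 : ∀ i, HasCompactSupport (pd (pd baseBump i) i) := fun i =>
    (hc1 i).fderiv_apply ℝ (ee i)
  have hf1 := fun i => pd_contDiff hf i
  have hf2 := fun i => pd_contDiff (hf1 i) i
  choose M₁ hM₁ using fun i => (hc1 i).exists_bound_of_continuous (hf1 i).continuous
  choose M₂ hM₂ using fun i => (hc2 i).exists_bound_of_continuous (hf2 i).continuous
  have p1 : ∀ i, 0 ≤ M₁ i := fun i => (norm_nonneg _).trans (hM₁ i 0)
  have p2 : ∀ i, 0 ≤ M₂ i := fun i => (norm_nonneg _).trans (hM₂ i 0)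
  refine ⟨∑ i, (M₁ i + M₂ i), Finset.sum_nonneg fun i _ => add_nonneg (p1 i) (p2 i),
    fun i y => ?_⟩
  have h : M₁ i + M₂ i ≤ ∑ i, (M₁ i + M₂ i) :=
    Finset.single_le_sum (f := fun i => M₁ i + M₂ i)
      (fun i _ => add_nonneg (p1 i) (p2 i)) (Finset.mem_univ i)
  have h1 := hM₁ i y
  have h2 := hM₂ i y
  rw [Real.norm_eq_abs] at h1 h2
  constructor <;> linarith [p1 i, p2 i]

/-- A rescaled spatial profile times the time elapsed since `s`. -/
def ramp (g : E3 → ℝ) (c : E3) (ρ s : ℝ) (z : E3 × ℝ) : ℝ := (z.2 - s) * g (ρ⁻¹ • (z.1 - c))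

lemma contDiff_ramp {g : E3 → ℝ} (hg : ContDiff ℝ (⊤ : ℕ∞) g) (c : E3) (ρ s : ℝ) :
    ContDiff ℝ (⊤ : ℕ∞) (ramp g c ρ s) := by
  unfold ramp
  fun_prop

lemma dirD_space_ramp {g : E3 → ℝ} (hg : ContDiff ℝ (⊤ : ℕ∞) g) (c : E3) (ρ s : ℝ) (i : Fin 3) :
    dirD (es i) (ramp g c ρ s) = ramp (fun y => ρ⁻¹ * pd g i y) c ρ s := by
  funext z
  obtain ⟨x, t⟩ := z
  rw [← pd_slice ((contDiff_ramp hg c ρ s).differentiable (by simp) _)]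
  have h1 : HasFDerivAt (fun y : E3 => ρ⁻¹ • (y - c)) (ρ⁻¹ • ContinuousLinearMap.id ℝ E3) x :=
    ((hasFDerivAt_id x).sub_const c).const_smul ρ⁻¹
  have h2 := ((hg.differentiable (by simp) (ρ⁻¹ • (x - c))).hasFDerivAt.comp x h1).const_mul (t - s)
  unfold pd ramp
  simp only
  rw [show (fun y => (t - s) * g (ρ⁻¹ • (y - c)))
    = fun y => (t - s) * (g ∘ fun y : E3 => ρ⁻¹ • (y - c)) y from rfl, h2.fderiv]
  simp

lemma dirD_time_ramp {g : E3 → ℝ} (hg : ContDiff ℝ (⊤ : ℕ∞) g) (c : E3) (ρ s : ℝ) (z : E3 × ℝ) :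
    dirD et (ramp g c ρ s) z = g (ρ⁻¹ • (z.1 - c)) := by
  obtain ⟨x, t⟩ := z
  refine (hasDerivAt_slice ((contDiff_ramp hg c ρ s).differentiable (by simp) _)).unique ?_
  unfold ramp
  simpa using ((hasDerivAt_id t).sub_const s).mul_const (g (ρ⁻¹ • (x - c)))

lemma mul_le_cube_add_rpow {a b : ℝ} (ha : 0 ≤ a) (hb : 0 ≤ b) :
    a * b ≤ a ^ 3 + b ^ (3 / 2 : ℝ) := by
  have e : b ^ (3 / 2 : ℝ) = b * √b := by
    rw [Real.sqrt_eq_rpow, show (3 / 2 : ℝ) = 1 + 1 / 2 by norm_num,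
      Real.rpow_add_of_nonneg hb (by norm_num) (by norm_num), Real.rpow_one]
  have hs := Real.sq_sqrt hb
  have h0 := Real.sqrt_nonneg b
  rw [e]
  rcases le_total a (√b) with h | h
  · have := mul_le_mul_of_nonneg_right h hb
    have := pow_nonneg ha 3
    linarith
  · have h1 : b ≤ a ^ 2 := by nlinarith
    have h2 := mul_le_mul_of_nonneg_left h1 ha
    have := mul_nonneg hb h0
    nlinarith

lemma sq_le_inv_sq_add_mul_cube {a ρ : ℝ} (ha : 0 ≤ a) (hρ : 0 < ρ) :
    a ^ 2 ≤ (ρ ^ 2)⁻¹ + ρ * a ^ 3 := by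
  have hb : 0 ≤ ρ * a := by positivity
  have h : (ρ * a) ^ 2 ≤ 1 + (ρ * a) ^ 3 := by
    nlinarith [mul_nonneg hb (sq_nonneg (ρ * a - 1)), sq_nonneg (ρ * a - 1)]
  have e : (ρ ^ 2)⁻¹ + ρ * a ^ 3 = (1 + (ρ * a) ^ 3) / ρ ^ 2 := by field_simp
  rw [e, le_div_iff₀ (by positivity)]
  linarith [mul_pow ρ a 2]

/-- Pointwise bound of the right-hand side of the local energy identity. -/
lemma energySource_ramp_le {M : ℝ} (hM0 : 0 ≤ M)
    (hM : ∀ (i : Fin 3) (y : E3), |pd baseBump i y| ≤ M ∧ |pd (pd baseBump i) i y| ≤ M)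
    (u : E3 × ℝ → E3) (p : E3 × ℝ → ℝ) (c : E3) {ρ s : ℝ} (hρ : 0 < ρ) {z : E3 × ℝ}
    (h1 : s ≤ z.2) (h2 : z.2 ≤ s + 4 * ρ ^ 2) :
    energySource (fun j z => u z j) p (ramp baseBump c ρ s) z
      ≤ (1 + 48 * M) * ((ρ ^ 2)⁻¹ + ρ * ‖u z‖ ^ 3 + ρ * |p z| ^ (3 / 2 : ℝ)) := by
  have hf : ContDiff ℝ (⊤ : ℕ∞) (baseBump : E3 → ℝ) := baseBump.contDiff
  have hf1 : ∀ i, ContDiff ℝ (⊤ : ℕ∞) (fun y => ρ⁻¹ * pd baseBump i y) := fun i =>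
    contDiff_const.mul (pd_contDiff hf i)
  have hpd : ∀ i y, pd (fun y => ρ⁻¹ * pd baseBump i y) i y
      = ρ⁻¹ * pd (pd baseBump i) i y := by
    intro i y
    conv_lhs => unfold pd
    rw [fderiv_const_mul (a := fun y => fderiv ℝ (baseBump : E3 → ℝ) y (ee i))
      ((pd_contDiff hf i).differentiable (by simp) y)]
    rfl
  have hq : ∑ j, u z j * u z j = ‖u z‖ ^ 2 := by
    rw [EuclideanSpace.norm_sq_eq]
    simp [sq]
  have hui : ∀ i, |u z i| ≤ ‖u z‖ := fun i => by
    simpa using PiLp.norm_apply_le (u z) i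
  unfold energySource
  simp only [dirD_time_ramp hf, dirD_space_ramp hf, dirD_space_ramp (hf1 _), hq]
  set a := ‖u z‖
  have ha : 0 ≤ a := norm_nonneg _
  set y := ρ⁻¹ • (z.1 - c) with hy
  have hη0 : 0 ≤ z.2 - s := by linarith
  have hη1 : z.2 - s ≤ 4 * ρ ^ 2 := by linarith
  have hL : ∀ i, ramp (fun y => ρ⁻¹ * pd (fun y => ρ⁻¹ * pd baseBump i y) i y) c ρ s z
      ≤ 4 * M := by
    intro i
    unfold ramp
    simp only [hpd, ← hy]
    calc (z.2 - s) * (ρ⁻¹ * (ρ⁻¹ * pd (pd baseBump i) i y))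
        ≤ (z.2 - s) * (ρ⁻¹ * (ρ⁻¹ * M)) := by
          have := (le_abs_self _).trans (hM i y).2
          gcongr
      _ ≤ (4 * ρ ^ 2) * (ρ⁻¹ * (ρ⁻¹ * M)) := by gcongr
      _ = 4 * M := by field_simp
  have hG : ∀ i, u z i * ramp (fun y => ρ⁻¹ * pd baseBump i y) c ρ s z ≤ a * (4 * ρ * M) ∧
      -(a * (4 * ρ * M)) ≤ u z i * ramp (fun y => ρ⁻¹ * pd baseBump i y) c ρ s z := by
    intro i
    have : |u z i * ramp (fun y => ρ⁻¹ * pd baseBump i y) c ρ s z| ≤ a * (4 * ρ * M) := by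
      rw [abs_mul]
      refine mul_le_mul (hui i) ?_ (abs_nonneg _) ha
      unfold ramp
      rw [← hy, abs_mul, abs_mul, abs_of_nonneg hη0, abs_of_pos (inv_pos.2 hρ)]
      calc (z.2 - s) * (ρ⁻¹ * |pd baseBump i y|) ≤ (4 * ρ ^ 2) * (ρ⁻¹ * M) := by
            have := (hM i y).1
            gcongr
        _ = 4 * ρ * M := by field_simp
    have := abs_le.1 this
    exact ⟨by linarith, this.1⟩
  have hS : |∑ i, u z i * ramp (fun y => ρ⁻¹ * pd baseBump i y) c ρ s z|
      ≤ 12 * M * ρ * a := by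
    rw [Fin.sum_univ_three, abs_le]
    constructor <;> linarith [hG 0, hG 1, hG 2]
  have hb : baseBump y ≤ 1 := baseBump.le_one
  have hA : a ^ 2 * (baseBump y
      + ∑ i, ramp (fun y => ρ⁻¹ * pd (fun y => ρ⁻¹ * pd baseBump i y) i y) c ρ s z)
      ≤ a ^ 2 * (1 + 12 * M) := by
    refine mul_le_mul_of_nonneg_left ?_ (sq_nonneg a)
    rw [Fin.sum_univ_three]
    linarith [hL 0, hL 1, hL 2]
  have hp : |a ^ 2 + 2 * p z| ≤ a ^ 2 + 2 * |p z| := by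
    refine (abs_add_le _ _).trans ?_
    rw [abs_mul, abs_of_nonneg (sq_nonneg a), abs_two]
  have hB : (a ^ 2 + 2 * p z) * ∑ i, u z i * ramp (fun y => ρ⁻¹ * pd baseBump i y) c ρ s z
      ≤ (a ^ 2 + 2 * |p z|) * (12 * M * ρ * a) := by
    refine (le_abs_self _).trans ?_
    rw [abs_mul]
    exact mul_le_mul hp hS (abs_nonneg _) (by positivity)
  have k1 := sq_le_inv_sq_add_mul_cube ha hρ
  have k2 := mul_le_cube_add_rpow ha (abs_nonneg (p z))
  set P := |p z| ^ (3 / 2 : ℝ)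
  have hP : 0 ≤ P := by positivity
  have k3 := mul_le_mul_of_nonneg_left k1 (by positivity : 0 ≤ 1 + 12 * M)
  have k4 := mul_le_mul_of_nonneg_left k2 (by positivity : 0 ≤ 24 * M * ρ)
  have i1 : 0 ≤ M * (ρ ^ 2)⁻¹ := by positivity
  have i2 : 0 ≤ ρ * P := by positivity
  have i3 : 0 ≤ M * ρ * P := by positivity
  nlinarith

lemma ramp_baseBump_eq_zero (c : E3) {ρ : ℝ} (hρ : 0 < ρ) (s : ℝ) (z : E3 × ℝ)
    (hz : 3 / 2 * ρ ≤ dist z.1 c) : ramp baseBump c ρ s z = 0 := by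
  have : baseBump (ρ⁻¹ • (z.1 - c)) = 0 := by
    refine baseBump.zero_of_le_dist ?_
    rw [dist_zero_right, norm_smul, Real.norm_eq_abs, abs_of_pos (inv_pos.2 hρ),
      ← dist_eq_norm, le_inv_mul_iff₀ hρ]
    change ρ * (3 / 2) ≤ _
    linarith
  unfold ramp
  rw [this, mul_zero]

lemma ramp_baseBump_eq (c : E3) {ρ : ℝ} (hρ : 0 < ρ) (s : ℝ) (z : E3 × ℝ)
    (hz : z.1 ∈ Metric.ball c ρ) : ramp baseBump c ρ s z = z.2 - s := by
  have : baseBump (ρ⁻¹ • (z.1 - c)) = 1 := by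
    refine baseBump.one_of_mem_closedBall ?_
    rw [mem_closedBall_zero_iff, norm_smul, Real.norm_eq_abs, abs_of_pos (inv_pos.2 hρ),
      ← dist_eq_norm, inv_mul_le_iff₀ hρ]
    change _ ≤ ρ * 1
    linarith [Metric.mem_ball.1 hz]
  unfold ramp
  rw [this, mul_one]

lemma integral_cylinder_const (c : E3) {ρ t : ℝ} (hρ : 0 < ρ) (k : ℝ) :
    ∫ _ in Metric.ball c (2 * ρ) ×ˢ Ioo (t - (2 * ρ) ^ 2) t, k
      = 32 * (volume : Measure E3).real (Metric.ball 0 1) * ρ ^ 5 * k := by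
  have hb : (volume : Measure E3).real (Metric.ball c (2 * ρ))
      = (2 * ρ) ^ 3 * (volume : Measure E3).real (Metric.ball 0 1) := by
    rw [measureReal_def, Measure.addHaar_ball_of_pos _ _ (by positivity), ENNReal.toReal_mul,
      ENNReal.toReal_ofReal (by positivity), finrank_euclideanSpace_fin, measureReal_def]
  rw [setIntegral_const, Measure.volume_eq_prod, measureReal_prod_prod, hb,
    Real.volume_real_Ioo_of_le (by nlinarith)]
  simp only [smul_eq_mul]
  ring

/-- Bounds on the inner cylinder extracted from a bound of the ramp-weighted energy. -/
lemma inner_bounds_of_ramp_bound {q d : E3 × ℝ → ℝ} (hq : Continuous q) (hd : Continuous d)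
    (hq0 : ∀ z, 0 ≤ q z) (hd0 : ∀ z, 0 ≤ d z) {c : E3} {t₀ ρ R : ℝ} (hρ : 0 < ρ)
    (h : ∀ T, t₀ - (2 * ρ) ^ 2 ≤ T → T ≤ t₀ →
      (∫ x in Metric.ball c (2 * ρ), q (x, T) * ramp baseBump c ρ (t₀ - (2 * ρ) ^ 2) (x, T))
        + ∫ z in Metric.ball c (2 * ρ) ×ˢ Ioo (t₀ - (2 * ρ) ^ 2) T,
          2 * ramp baseBump c ρ (t₀ - (2 * ρ) ^ 2) z * d z ≤ R) :
    (∀ T ∈ Ioo (t₀ - ρ ^ 2) t₀, 3 * ρ ^ 2 * ∫ x in Metric.ball c ρ, q (x, T) ≤ R) ∧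
      3 * ρ ^ 2 * ∫ z in Metric.ball c ρ ×ˢ Ioo (t₀ - ρ ^ 2) t₀, d z ≤ R := by
  set s := t₀ - (2 * ρ) ^ 2 with hs
  have hs' : s = t₀ - 4 * ρ ^ 2 := by rw [hs]; ring
  have hρ2 : 0 < ρ ^ 2 := by positivity
  have hφ : Continuous (ramp baseBump c ρ s) := (contDiff_ramp baseBump.contDiff c ρ s).continuous
  have hφ0 : ∀ z : E3 × ℝ, s ≤ z.2 → 0 ≤ ramp baseBump c ρ s z := fun z hz =>
    mul_nonneg (sub_nonneg.2 hz) baseBump.nonneg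
  have hφ1 : ∀ z : E3 × ℝ, z.1 ∈ Metric.ball c ρ → t₀ - ρ ^ 2 ≤ z.2 →
      3 * ρ ^ 2 ≤ ramp baseBump c ρ s z := fun z hz ht => by
    rw [ramp_baseBump_eq c hρ s _ hz]
    linarith
  have hφd : Continuous fun z => 2 * ramp baseBump c ρ s z * d z := by fun_prop
  have hball : Metric.ball c ρ ⊆ Metric.ball c (2 * ρ) := Metric.ball_subset_ball (by linarith)
  constructor
  · intro T hT
    have hsT : s ≤ T := by linarith [hT.1]
    have hm := h T hsT hT.2.le
    have hpos : 0 ≤ ∫ z in Metric.ball c (2 * ρ) ×ˢ Ioo s T,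
        2 * ramp baseBump c ρ s z * d z :=
      setIntegral_nonneg (measurableSet_ball.prod measurableSet_Ioo) fun z hz =>
        mul_nonneg (mul_nonneg zero_le_two (hφ0 z hz.2.1.le)) (hd0 z)
    have hci : ∀ F : E3 → ℝ, Continuous F → ∀ r, IntegrableOn F (Metric.ball c r) :=
      fun F hF r => (hF.continuousOn.integrableOn_compact (isCompact_closedBall c r)).mono_set
        Metric.ball_subset_closedBall
    have hc2 : Continuous fun x => q (x, T) * ramp baseBump c ρ s (x, T) := by fun_prop
    rw [← integral_const_mul]
    have a1 : ∫ x in Metric.ball c ρ, 3 * ρ ^ 2 * q (x, T)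
        ≤ ∫ x in Metric.ball c ρ, q (x, T) * ramp baseBump c ρ s (x, T) := by
      refine setIntegral_mono_on (hci _ (by fun_prop) _) (hci _ hc2 _)
        measurableSet_ball fun x hx => ?_
      rw [mul_comm]
      exact mul_le_mul_of_nonneg_left (hφ1 _ hx hT.1.le) (hq0 _)
    have a2 := setIntegral_mono_set (hci _ hc2 _)
      (Filter.Eventually.of_forall fun x => mul_nonneg (hq0 _) (hφ0 (x, T) hsT))
      hball.eventuallyLE
    linarith
  · have hst : s ≤ t₀ := by linarith
    have hm := h t₀ hst le_rfl
    have hpos : 0 ≤ ∫ x in Metric.ball c (2 * ρ), q (x, t₀) * ramp baseBump c ρ s (x, t₀) :=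
      setIntegral_nonneg measurableSet_ball fun x _ => mul_nonneg (hq0 _) (hφ0 _ hst)
    rw [← integral_const_mul]
    have hsub : Metric.ball c ρ ×ˢ Ioo (t₀ - ρ ^ 2) t₀ ⊆ Metric.ball c (2 * ρ) ×ˢ Ioo s t₀ :=
      prod_mono hball (Ioo_subset_Ioo_left (by linarith))
    have hnn : ∀ᵐ z ∂volume.restrict (Metric.ball c (2 * ρ) ×ˢ Ioo s t₀),
        0 ≤ 2 * ramp baseBump c ρ s z * d z :=
      (ae_restrict_iff' (measurableSet_ball.prod measurableSet_Ioo)).2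
        (Filter.Eventually.of_forall fun z hz =>
          mul_nonneg (mul_nonneg zero_le_two (hφ0 z hz.2.1.le)) (hd0 z))
    have a1 : ∫ z in Metric.ball c ρ ×ˢ Ioo (t₀ - ρ ^ 2) t₀, 3 * ρ ^ 2 * d z
        ≤ ∫ z in Metric.ball c ρ ×ˢ Ioo (t₀ - ρ ^ 2) t₀, 2 * ramp baseBump c ρ s z * d z := by
      refine setIntegral_mono_on (integrableOn_cylinder (by fun_prop) _ _ _ _)
        (integrableOn_cylinder hφd _ _ _ _) (measurableSet_ball.prod measurableSet_Ioo)
        fun z hz => mul_le_mul_of_nonneg_right ?_ (hd0 z)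
      linarith [hφ1 z hz.1 hz.2.1.le]
    have a2 := setIntegral_mono_set (integrableOn_cylinder hφd _ _ _ _) hnn hsub.eventuallyLE
    linarith

lemma integral_majorant_le {a b : E3 × ℝ → ℝ} (ha : Continuous a) (hb : Continuous b)
    (ha0 : ∀ z, 0 ≤ a z) (hb0 : ∀ z, 0 ≤ b z) {k : ℝ} (hk : 0 ≤ k) (c : E3) (t₀ : ℝ) {ρ : ℝ}
    (hρ : 0 < ρ) :
    ∫ z in Metric.ball c (2 * ρ) ×ˢ Ioo (t₀ - (2 * ρ) ^ 2) t₀,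
        k * ((ρ ^ 2)⁻¹ + ρ * a z + ρ * b z)
      ≤ k * (32 * (volume : Measure E3).real (Metric.ball 0 1) + 4) * ρ ^ 3 *
        (1 + ((2 * ρ) ^ 2)⁻¹ * (∫ z in Metric.ball c (2 * ρ) ×ˢ Ioo (t₀ - (2 * ρ) ^ 2) t₀, a z)
          + ((2 * ρ) ^ 2)⁻¹ * ∫ z in Metric.ball c (2 * ρ) ×ˢ Ioo (t₀ - (2 * ρ) ^ 2) t₀, b z) := by
  have hβ0 : 0 ≤ (volume : Measure E3).real (Metric.ball 0 1) := measureReal_nonneg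
  have j0 : IntegrableOn (fun _ : E3 × ℝ => (ρ ^ 2)⁻¹)
      (Metric.ball c (2 * ρ) ×ˢ Ioo (t₀ - (2 * ρ) ^ 2) t₀) :=
    integrableOn_cylinder (by fun_prop) c _ _ _
  have j1 : IntegrableOn (fun z => ρ * a z)
      (Metric.ball c (2 * ρ) ×ˢ Ioo (t₀ - (2 * ρ) ^ 2) t₀) :=
    integrableOn_cylinder (by fun_prop) c _ _ _
  have j2 : IntegrableOn (fun z => ρ * b z)
      (Metric.ball c (2 * ρ) ×ˢ Ioo (t₀ - (2 * ρ) ^ 2) t₀) :=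
    integrableOn_cylinder (by fun_prop) c _ _ _
  have j01 : IntegrableOn (fun z => (ρ ^ 2)⁻¹ + ρ * a z)
      (Metric.ball c (2 * ρ) ×ˢ Ioo (t₀ - (2 * ρ) ^ 2) t₀) := j0.add j1
  rw [integral_const_mul, integral_add j01 j2, integral_add j0 j1,
    integral_const_mul, integral_const_mul, integral_cylinder_const c hρ]
  have hI : 0 ≤ ∫ z in Metric.ball c (2 * ρ) ×ˢ Ioo (t₀ - (2 * ρ) ^ 2) t₀, a z :=
    integral_nonneg ha0
  have hJ : 0 ≤ ∫ z in Metric.ball c (2 * ρ) ×ˢ Ioo (t₀ - (2 * ρ) ^ 2) t₀, b z :=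
    integral_nonneg hb0
  generalize (∫ z in Metric.ball c (2 * ρ) ×ˢ Ioo (t₀ - (2 * ρ) ^ 2) t₀, a z) = I at hI ⊢
  generalize (∫ z in Metric.ball c (2 * ρ) ×ˢ Ioo (t₀ - (2 * ρ) ^ 2) t₀, b z) = J at hJ ⊢
  generalize (volume : Measure E3).real (Metric.ball 0 1) = β at hβ0 ⊢
  have e1 : k * (32 * β + 4) * ρ ^ 3 * (1 + ((2 * ρ) ^ 2)⁻¹ * I + ((2 * ρ) ^ 2)⁻¹ * J)
      = k * ((32 * β + 4) * ρ ^ 3 + (8 * β + 1) * ρ * I + (8 * β + 1) * ρ * J) := by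
    field_simp
    ring
  have e2 : 32 * β * ρ ^ 5 * (ρ ^ 2)⁻¹ = 32 * β * ρ ^ 3 := by field_simp
  rw [e1, e2]
  refine mul_le_mul_of_nonneg_left ?_ hk
  have h1 : 0 ≤ β * ρ * I := by positivity
  have h2 : 0 ≤ β * ρ * J := by positivity
  have h3 : 0 ≤ ρ ^ 3 := by positivity
  linarith

/-- The local energy estimate for globally defined smooth functions. -/
lemma exists_local_energy_bound : ∃ N : ℝ, 0 ≤ N ∧
    ∀ (u : E3 × ℝ → E3) (p : E3 × ℝ → ℝ), ContDiff ℝ (⊤ : ℕ∞) u → ContDiff ℝ (⊤ : ℕ∞) p →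
    ∀ (c : E3) (t₀ ρ : ℝ), 0 < ρ →
      (∀ z ∈ Metric.ball c (2 * ρ) ×ˢ Ioo (t₀ - (2 * ρ) ^ 2) t₀, NSAt (fun j z => u z j) p z) →
      ∀ S : ℝ, S = 1 + ((2 * ρ) ^ 2)⁻¹ * (∫ z in Metric.ball c (2 * ρ) ×ˢ
            Ioo (t₀ - (2 * ρ) ^ 2) t₀, ‖u z‖ ^ 3)
          + ((2 * ρ) ^ 2)⁻¹ * (∫ z in Metric.ball c (2 * ρ) ×ˢ Ioo (t₀ - (2 * ρ) ^ 2) t₀,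
            |p z| ^ (3 / 2 : ℝ)) →
      (∀ T ∈ Ioo (t₀ - ρ ^ 2) t₀, ρ⁻¹ * ∫ x in Metric.ball c ρ, ‖u (x, T)‖ ^ 2 ≤ N * S) ∧
      ρ⁻¹ * (∫ z in Metric.ball c ρ ×ˢ Ioo (t₀ - ρ ^ 2) t₀,
          ∑ j, ∑ i, dirD (es i) (fun z => u z j) z ^ 2) ≤ N * S := by
  obtain ⟨M, hM0, hM⟩ := exists_baseBump_bound
  have hβ0 : 0 ≤ (volume : Measure E3).real (Metric.ball 0 1) := measureReal_nonneg
  refine ⟨(1 + 48 * M) * (32 * (volume : Measure E3).real (Metric.ball 0 1) + 4),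
    by positivity, ?_⟩
  intro u p hu hp c t₀ ρ hρ hNS S hS
  have huc := hu.continuous
  have hcp : Continuous fun z => |p z| ^ (3 / 2 : ℝ) :=
    hp.continuous.abs.rpow_const fun _ => Or.inr (by norm_num)
  have hcu : Continuous fun z => ‖u z‖ ^ 3 := by fun_prop
  have hcq : Continuous fun z => ‖u z‖ ^ 2 := by fun_prop
  have hmaj := integral_majorant_le hcu hcp (fun z => by positivity) (fun z => by positivity)
    (by positivity : 0 ≤ 1 + 48 * M) c t₀ hρ
  rw [← hS] at hmaj
  have hS0 : 0 ≤ S := by rw [hS]; positivity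
  have hv : ∀ j, ContDiff ℝ (⊤ : ℕ∞) (fun z => u z j) := fun j => by fun_prop
  have hq : ∀ z, ∑ j, u z j * u z j = ‖u z‖ ^ 2 := fun z => by
    rw [EuclideanSpace.norm_sq_eq]
    simp [sq]
  have hφ := contDiff_ramp (g := baseBump) baseBump.contDiff c ρ (t₀ - (2 * ρ) ^ 2)
  have hdiss : Continuous fun z => ∑ j, ∑ i, dirD (es i) (fun z => u z j) z ^ 2 := by
    have := fun i j => (dirD_contDiff (w := es i) (hv j)).continuous
    fun_prop
  have hB : Continuous fun z =>
      (1 + 48 * M) * ((ρ ^ 2)⁻¹ + ρ * ‖u z‖ ^ 3 + ρ * |p z| ^ (3 / 2 : ℝ)) := by fun_prop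
  have key := inner_bounds_of_ramp_bound hcq hdiss (fun z => sq_nonneg _)
    (fun z => Finset.sum_nonneg fun j _ => Finset.sum_nonneg fun i _ => sq_nonneg _)
    (c := c) (t₀ := t₀)
    (R := (1 + 48 * M) * (32 * (volume : Measure E3).real (Metric.ball 0 1) + 4) * ρ ^ 3 * S)
    hρ (fun T hsT hT => by
      have hsub : Metric.ball c (2 * ρ) ×ˢ Ioo (t₀ - (2 * ρ) ^ 2) T ⊆
          Metric.ball c (2 * ρ) ×ˢ Ioo (t₀ - (2 * ρ) ^ 2) t₀ :=
        prod_mono subset_rfl (Ioo_subset_Ioo_right hT)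
      have := local_energy_equality hv hp hφ (c := c) (r' := 3 / 2 * ρ) (r := 2 * ρ)
        (by linarith) hsT (fun z hz => ramp_baseBump_eq_zero c hρ _ z hz)
        (fun x => by simp [ramp]) (fun z hz => hNS z (hsub hz))
      simp only [hq] at this
      rw [this]
      refine le_trans (setIntegral_mono_on
        (integrableOn_cylinder (contDiff_energySource hv hp hφ).continuous _ _ _ _)
        (integrableOn_cylinder hB _ _ _ _) (measurableSet_ball.prod measurableSet_Ioo)
        fun z hz => energySource_ramp_le hM0 hM u p c hρ hz.2.1.le
          (by linarith [hz.2.2, mul_pow 2 ρ 2])) ?_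
      exact (setIntegral_mono_set (integrableOn_cylinder hB _ _ _ _)
        (Filter.Eventually.of_forall fun z => by positivity) hsub.eventuallyLE).trans hmaj)
  have hN0 : 0 ≤ (1 + 48 * M) * (32 * (volume : Measure E3).real (Metric.ball 0 1) + 4) := by
    positivity
  generalize (1 + 48 * M) * (32 * (volume : Measure E3).real (Metric.ball 0 1) + 4) = N
    at key hN0 ⊢
  have hdiv : ∀ J : ℝ, 3 * ρ ^ 2 * J ≤ N * ρ ^ 3 * S → ρ⁻¹ * J ≤ N * S := by
    intro J hJ
    rw [inv_mul_le_iff₀ hρ]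
    have h1 : ρ ^ 2 * (3 * J) ≤ ρ ^ 2 * (ρ * (N * S)) := by linarith
    have h2 := le_of_mul_le_mul_left h1 (by positivity)
    have h3 : 0 ≤ ρ * (N * S) := by positivity
    linarith
  exact ⟨fun T hT => hdiv _ (key.1 T hT), hdiv _ key.2⟩

/-- A function smooth on an open set agrees near any closed subset with a smooth function. -/
lemma exists_contDiff_eq_nhds {F : Type*} [NormedAddCommGroup F] [NormedSpace ℝ F]
    {f : E3 × ℝ → F} {U K : Set (E3 × ℝ)} (hU : IsOpen U) (hf : ContDiffOn ℝ (⊤ : ℕ∞) f U)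
    (hK : IsClosed K) (hKU : K ⊆ U) :
    ∃ g : E3 × ℝ → F, ContDiff ℝ (⊤ : ℕ∞) g ∧ ∀ z ∈ K, g =ᶠ[nhds z] f := by
  obtain ⟨ψ, h0, h1, -⟩ := exists_contMDiffMap_zero_one_nhds_of_isClosed
    (n := ⊤) (modelWithCornersSelf ℝ (E3 × ℝ)) hU.isClosed_compl hK
    (disjoint_left.2 fun z hz hzK => hz (hKU hzK))
  have hψ : ContDiff ℝ (⊤ : ℕ∞) (ψ : E3 × ℝ → ℝ) := ψ.contMDiff.contDiff
  refine ⟨fun z => ψ z • f z, contDiff_iff_contDiffAt.2 fun z => ?_, fun z hz => ?_⟩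
  · by_cases hz : z ∈ U
    · exact hψ.contDiffAt.smul (hf.contDiffAt (hU.mem_nhds hz))
    · have : (fun z => ψ z • f z) =ᶠ[nhds z] fun _ => 0 := by
        filter_upwards [eventually_nhdsSet_iff_forall.1 h0 z hz] with y hy
        rw [hy, zero_smul]
      exact contDiffAt_const.congr_of_eventuallyEq this
  · filter_upwards [eventually_nhdsSet_iff_forall.1 h1 z hz] with y hy
    rw [hy, one_smul]

theorem slice_space_eventuallyEq {F G : E3 × ℝ → ℝ} {x : E3} {t : ℝ}
    (hFG : F =ᶠ[nhds (x, t)] G) : (fun y => G (y, t)) =ᶠ[nhds x] fun y => F (y, t) := by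
  have hc : ContinuousAt (fun y : E3 => (y, t)) x := by fun_prop
  filter_upwards [hc.eventually hFG] with y hy using hy.symm

theorem slice_time_eventuallyEq {F G : E3 × ℝ → ℝ} {x : E3} {t : ℝ}
    (hFG : F =ᶠ[nhds (x, t)] G) : (fun s => G (x, s)) =ᶠ[nhds t] fun s => F (x, s) := by
  have hc : ContinuousAt (fun s : ℝ => (x, s)) t := by fun_prop
  filter_upwards [hc.eventually hFG] with y hy using hy.symm

theorem pd_slice_of_eventuallyEq {F G : E3 × ℝ → ℝ} {x : E3} {t : ℝ}
    (hF : ContDiff ℝ (⊤ : ℕ∞) F) (hFG : F =ᶠ[nhds (x, t)] G) (i : Fin 3) :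
    pd (fun y => G (y, t)) i x = dirD (es i) F (x, t) := by
  rw [← pd_slice (hF.differentiable (by simp)).differentiableAt i]
  simp only [pd, (slice_space_eventuallyEq hFG).fderiv_eq]

theorem lap_slice_of_eventuallyEq {F G : E3 × ℝ → ℝ} {x : E3} {t : ℝ}
    (hF : ContDiff ℝ (⊤ : ℕ∞) F) (hFG : F =ᶠ[nhds (x, t)] G) :
    lap (fun y => G (y, t)) x = ∑ i, dirD (es i) (dirD (es i) F) (x, t) := by
  have hc : ContinuousAt (fun y : E3 => (y, t)) x := by fun_prop
  refine Finset.sum_congr rfl fun i _ => ?_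
  rw [← pd_slice ((dirD_contDiff hF).differentiable (by simp)).differentiableAt i]
  have : (fun y => pd (fun y => G (y, t)) i y) =ᶠ[nhds x] fun y => dirD (es i) F (y, t) := by
    filter_upwards [hc.eventually hFG.eventually_nhds] with y hy
    exact pd_slice_of_eventuallyEq hF hy i
  simp only [pd] at this ⊢
  rw [this.fderiv_eq]

theorem deriv_slice_of_eventuallyEq {F G : E3 × ℝ → ℝ} {x : E3} {t : ℝ}
    (hF : ContDiff ℝ (⊤ : ℕ∞) F) (hFG : F =ᶠ[nhds (x, t)] G) :
    deriv (fun s => G (x, s)) t = dirD et F (x, t) := by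
  rw [(slice_time_eventuallyEq hFG).deriv_eq]
  exact (hasDerivAt_slice (hF.differentiable (by simp)).differentiableAt).deriv

theorem contDiff_component {v : E3 × ℝ → E3} (hv : ContDiff ℝ (⊤ : ℕ∞) v) (j : Fin 3) :
    ContDiff ℝ (⊤ : ℕ∞) fun z => v z j :=
  (contDiff_euclidean.1 hv) j

theorem IsNSQ1.nsAt {u : E3 → ℝ → E3} {P : E3 → ℝ → ℝ} {U : Set (E3 × ℝ)}
    (h : IsNSQ1 u P U) {v : E3 × ℝ → E3} {p : E3 × ℝ → ℝ}
    (hv : ContDiff ℝ (⊤ : ℕ∞) v) (hp : ContDiff ℝ (⊤ : ℕ∞) p) {z : E3 × ℝ} (hz : z ∈ U)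
    (hvu : v =ᶠ[nhds z] fun z => u z.1 z.2) (hpP : p =ᶠ[nhds z] fun z => P z.1 z.2) :
    NSAt (fun j z => v z j) p z := by
  obtain ⟨x, t⟩ := z
  have hj : ∀ j, (fun z => v z j) =ᶠ[nhds (x, t)] fun z => u z.1 z.2 j := fun j =>
    hvu.fun_comp fun w => w j
  have hpd : ∀ j i, pd (fun y => u y t j) i x = dirD (es i) (fun z => v z j) (x, t) :=
    fun j i => pd_slice_of_eventuallyEq (contDiff_component hv j) (hj j) i
  refine ⟨fun j => ?_, ?_⟩
  · have := h.momentum x t hz j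
    rw [show deriv (fun s => u x s j) t = _ from
        deriv_slice_of_eventuallyEq (contDiff_component hv j) (hj j),
      show lap (fun y => u y t j) x = _ from
        lap_slice_of_eventuallyEq (contDiff_component hv j) (hj j),
      show pd (fun y => P y t) j x = _ from pd_slice_of_eventuallyEq hp hpP j] at this
    simp only [hpd] at this
    simpa only [hvu.self_of_nhds] using this
  · simpa only [hpd] using h.divfree x t hz

theorem Qyl_double_subset {z₀ : E3 × ℝ} (hz₀ : z₀ ∈ Qyl (0, 0) (1/8)) {ρ : ℝ} (hρ : 0 < ρ)
    (hρ' : ρ ≤ 1/4) : Qyl z₀ (2 * ρ) ⊆ Qyl (0, 0) 1 := by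
  obtain ⟨hx, ht⟩ := hz₀
  rintro ⟨x, t⟩ ⟨hx', ht'⟩
  simp only [mem_ball_iff_norm, mem_Ioo, sub_zero] at *
  have := norm_sub_norm_le x z₀.1
  exact ⟨by simp only [mem_ball_iff_norm, sub_zero]; linarith,
    by dsimp only; nlinarith, by dsimp only; linarith⟩

theorem Qyl_subset_double (z₀ : E3 × ℝ) {ρ : ℝ} (hρ : 0 < ρ) :
    Qyl z₀ ρ ⊆ Qyl z₀ (2 * ρ) :=
  prod_mono (Metric.ball_subset_ball (by linarith)) (Ioo_subset_Ioo_left (by nlinarith))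

theorem integral_Qyl_of_eqOn {F : E3 × ℝ → ℝ} (hF : Continuous F) {f : E3 → ℝ → ℝ}
    {z₀ : E3 × ℝ} {r : ℝ} (hfF : ∀ x t, (x, t) ∈ Qyl z₀ r → f x t = F (x, t)) :
    ∫ t in Ioo (z₀.2 - r ^ 2) z₀.2, ∫ x in Metric.ball z₀.1 r, f x t = ∫ z in Qyl z₀ r, F z := by
  rw [Qyl, ← integral_cylinder hF]
  exact setIntegral_congr_fun measurableSet_Ioo fun t ht =>
    setIntegral_congr_fun measurableSet_ball fun x hx => hfF x t ⟨hx, ht⟩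

/-- local energy estimate. -/
theorem local_energy_estimate :
    ∃ N : ℝ, ∀ (u : E3 → ℝ → E3) (P : E3 → ℝ → ℝ) (U : Set (E3 × ℝ)),
      IsNSQ1 u P U →
      ∀ z₀ : E3 × ℝ, z₀ ∈ Qyl (0, 0) (1/8) →
      ∀ ρ : ℝ, 0 < ρ → ρ ≤ 1/4 →
        AA u z₀ ρ + EE u z₀ ρ ≤ N * (1 + CC u z₀ (2*ρ) + DD P z₀ (2*ρ)) := by
  obtain ⟨N, hN, hbound⟩ := exists_local_energy_bound
  refine ⟨2 * N, fun u P U h z₀ hz₀ ρ hρ hρ' => ?_⟩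
  obtain ⟨v, hv, hvu⟩ := exists_contDiff_eq_nhds h.open_U h.smooth_u isClosed_closure h.subset_U
  obtain ⟨p, hp, hpP⟩ := exists_contDiff_eq_nhds h.open_U h.smooth_P isClosed_closure h.subset_U
  have hbig : Qyl z₀ (2 * ρ) ⊆ closure (Qyl (0, 0) 1) :=
    (Qyl_double_subset hz₀ hρ hρ').trans subset_closure
  have hsmall : Qyl z₀ ρ ⊆ closure (Qyl (0, 0) 1) := (Qyl_subset_double z₀ hρ).trans hbig
  have hval : ∀ x t, (x, t) ∈ closure (Qyl (0, 0) 1) → u x t = v (x, t) := fun x t hz =>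
    (hvu _ hz).self_of_nhds.symm
  have hC : CC u z₀ (2 * ρ) = ((2 * ρ) ^ 2)⁻¹ * ∫ z in Qyl z₀ (2 * ρ), ‖v z‖ ^ 3 := by
    rw [CC, integral_Qyl_of_eqOn (F := fun z => ‖v z‖ ^ 3) (hv.continuous.norm.pow 3)
      fun x t hz => by rw [hval x t (hbig hz)]]
  have hD : DD P z₀ (2 * ρ) = ((2 * ρ) ^ 2)⁻¹ * ∫ z in Qyl z₀ (2 * ρ), |p z| ^ (3/2 : ℝ) := by
    rw [DD, integral_Qyl_of_eqOn (F := fun z => |p z| ^ (3/2 : ℝ))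
      (hp.continuous.abs.rpow_const fun _ => Or.inr (by norm_num))
      fun x t hz => by rw [(hpP _ (hbig hz)).self_of_nhds]]
  have hE : EE u z₀ ρ = ρ⁻¹ * ∫ z in Qyl z₀ ρ,
      ∑ j, ∑ i, dirD (es i) (fun z => v z j) z ^ 2 := by
    rw [EE, integral_Qyl_of_eqOn
      (F := fun z => ∑ j, ∑ i, dirD (es i) (fun z => v z j) z ^ 2)
      (continuous_finsetSum _ fun j _ => continuous_finsetSum _ fun i _ =>
        (dirD_contDiff (contDiff_component hv j)).continuous.pow 2) fun x t hz => ?_]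
    refine Finset.sum_congr rfl fun j _ => Finset.sum_congr rfl fun i _ => ?_
    rw [← pd_slice_of_eventuallyEq (contDiff_component hv j)
      ((hvu _ (hsmall hz)).fun_comp fun w => w j) i]
    rfl
  obtain ⟨hA, hE'⟩ := hbound v p hv hp z₀.1 z₀.2 ρ hρ
    (fun z hz => h.nsAt hv hp (h.subset_U (hbig hz)) (hvu z (hbig hz)) (hpP z (hbig hz)))
    (1 + CC u z₀ (2 * ρ) + DD P z₀ (2 * ρ)) (by rw [hC, hD]; rfl)
  have hS : 0 ≤ N * (1 + CC u z₀ (2 * ρ) + DD P z₀ (2 * ρ)) := by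
    rw [hC, hD]; positivity
  have hA' : AA u z₀ ρ ≤ N * (1 + CC u z₀ (2 * ρ) + DD P z₀ (2 * ρ)) := by
    refine Real.iSup_le (fun T => Real.iSup_le (fun hT => ?_) hS) hS
    rw [setIntegral_congr_fun (g := fun x => ‖v (x, T)‖ ^ 2) measurableSet_ball fun x hx => by
      dsimp only; rw [hval x T (hsmall ⟨hx, hT⟩)]]
    exact hA T hT
  have hE'' : EE u z₀ ρ ≤ N * (1 + CC u z₀ (2 * ρ) + DD P z₀ (2 * ρ)) := by
    rw [hE]; exact hE'
  linarith
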